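/- Let x0, y0, rho be real numbers with 0 < x0 ≤ 1, 0 < y0 ≤ 1 and rho > 0, and let A be the 6×6 real matrix whose rows are (1, 1/2, 1/2, 0, 0, 0), (1−y0, 0, (1−y0²)/2, y0, 0, y0²/2), (1−x0, (1−x0²)/2, 0, x0, x0²/2, 0), (−1, −x0, 0, 1, x0, 0), (−1, 0, −y0, 1, 0, y0), (0, −y0, −x0, 0, rho·y0, rho·x0). Then det(A) < 0; in particular A is invertible. -/

import Mathlib

open Matrix

theorem det_interface_formula (x0 y0 rho : ℝ) :
    Matrix.det !![(1 : ℝ), 1/2, 1/2, 0, 0, 0;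
      1 - y0, 0, (1 - y0^2)/2, y0, 0, y0^2/2;
      1 - x0, (1 - x0^2)/2, 0, x0, x0^2/2, 0;
      -1, -x0, 0, 1, x0, 0;
      -1, 0, -y0, 1, 0, y0;
      0, -y0, -x0, 0, rho * y0, rho * x0] =
      (1/4) * (x0^2 + y0^2) * (rho * (x0 * y0 - 1) - x0 * y0) := by
  simp [Matrix.det_succ_row_zero, Fin.sum_univ_succ, Fin.succAbove]
  ring

theorem det_interface_matrix_neg (x0 y0 rho : ℝ)
    (hx0 : 0 < x0) (hx1 : x0 ≤ 1) (hy0 : 0 < y0) (hy1 : y0 ≤ 1) (hrho : 0 < rho) :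
    Matrix.det !![(1 : ℝ), 1/2, 1/2, 0, 0, 0;
      1 - y0, 0, (1 - y0^2)/2, y0, 0, y0^2/2;
      1 - x0, (1 - x0^2)/2, 0, x0, x0^2/2, 0;
      -1, -x0, 0, 1, x0, 0;
      -1, 0, -y0, 1, 0, y0;
      0, -y0, -x0, 0, rho * y0, rho * x0] < 0 ∧
    IsUnit !![(1 : ℝ), 1/2, 1/2, 0, 0, 0;
      1 - y0, 0, (1 - y0^2)/2, y0, 0, y0^2/2;
      1 - x0, (1 - x0^2)/2, 0, x0, x0^2/2, 0;
      -1, -x0, 0, 1, x0, 0;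
      -1, 0, -y0, 1, 0, y0;
      0, -y0, -x0, 0, rho * y0, rho * x0] := by
  have hneg : (1/4) * (x0^2 + y0^2) * (rho * (x0 * y0 - 1) - x0 * y0) < 0 := by
    have h1 : 0 < x0 * y0 := mul_pos hx0 hy0
    have h2 : x0 * y0 ≤ 1 := mul_le_one₀ hx1 hy0.le hy1
    have h3 : rho * (x0 * y0 - 1) ≤ 0 :=
      mul_nonpos_of_nonneg_of_nonpos hrho.le (by linarith)
    exact mul_neg_of_pos_of_neg (by positivity) (by linarith)
  have hdet := det_interface_formula x0 y0 rho
  rw [Matrix.isUnit_iff_isUnit_det, hdet]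
  exact ⟨hneg, isUnit_iff_ne_zero.mpr hneg.ne⟩
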